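/- arXiv:1302.0829 — 2 statements merged into one kernel-verified Lean document; each statement's English description precedes it below -/
import Mathlib

section
/- Let K be a compact Hausdorff totally disconnected topological meet-semilattice with least element 0 and jointly continuous meet. The topology of K coincides with the topology generated by the family consisting of all clopen principal filters [p,→) (for p a compact element of K) together with their complements K ∖ [p,→). -/
/-- An element `p` of a partially ordered set is a *compact element* if for every
subset `A` of which `p` is a least upper bound there exists a finite subset `A₀ ⊆ A`
of which `p` is a least upper bound. -/
def CompactElem {K : Type*} [PartialOrder K] (p : K) : Prop :=
  ∀ A : Set K, IsLUB A p → ∃ A₀ : Finset K, (A₀ : Set K) ⊆ A ∧ IsLUB (A₀ : Set K) p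

/-- Principal ideals are closed when the meet is continuous. -/
theorem isClosed_Iic_of_continuous_inf {K : Type*} [TopologicalSpace K] [T2Space K]
    [SemilatticeInf K] (hmeet : Continuous fun x : K × K => x.1 ⊓ x.2) (a : K) :
    IsClosed (Set.Iic a) := by
  have h : Set.Iic a = {z | z ⊓ a = z} := by ext z; simp
  rw [h]
  exact isClosed_eq (hmeet.comp (continuous_id.prodMk continuous_const)) continuous_id

/-- Principal filters are closed when the meet is continuous. -/
theorem isClosed_Ici_of_continuous_inf {K : Type*} [TopologicalSpace K] [T2Space K]
    [SemilatticeInf K] (hmeet : Continuous fun x : K × K => x.1 ⊓ x.2) (a : K) :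
    IsClosed (Set.Ici a) := by
  have h : Set.Ici a = {z | z ⊓ a = a} := by ext z; simp
  rw [h]
  exact isClosed_eq (hmeet.comp (continuous_id.prodMk continuous_const)) continuous_const

/-- An element of a compact semilattice whose principal filter is open is compact. -/
theorem compactElem_of_isOpen_Ici {K : Type*} [TopologicalSpace K] [CompactSpace K] [T2Space K]
    [SemilatticeInf K] (hmeet : Continuous fun x : K × K => x.1 ⊓ x.2) {p : K}
    (hp : IsOpen (Set.Ici p)) : CompactElem p := by
  classical
  intro A hA
  have hs : IsCompact (Set.Iic p ∩ (Set.Ici p)ᶜ) :=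
    ((isClosed_Iic_of_continuous_inf hmeet p).inter hp.isClosed_compl).isCompact
  obtain ⟨F, hF⟩ := hs.elim_finite_subfamily_closed (fun a : A => Set.Ici (a : K))
    (fun a => isClosed_Ici_of_continuous_inf hmeet _) (by
      rw [Set.eq_empty_iff_forall_notMem]
      rintro z ⟨⟨-, hz⟩, hz'⟩
      exact hz (hA.2 fun a ha => Set.mem_iInter.1 hz' ⟨a, ha⟩))
  refine ⟨F.image Subtype.val, ?_, ?_, ?_⟩
  · intro a ha
    obtain ⟨b, -, rfl⟩ := Finset.mem_image.1 ha
    exact b.2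
  · intro a ha
    obtain ⟨b, -, rfl⟩ := Finset.mem_image.1 ha
    exact hA.1 b.2
  · intro w hw
    by_contra hpw
    refine Set.eq_empty_iff_forall_notMem.1 hF (w ⊓ p) ⟨⟨inf_le_right, ?_⟩, ?_⟩
    · exact fun h => hpw (le_trans h inf_le_left)
    · refine Set.mem_iInter₂.2 fun b hb => ?_
      exact le_inf (hw (Finset.mem_image_of_mem _ hb)) (hA.1 b.2)

/-- A nonempty closed subsemilattice of a compact semilattice has a least element. -/
theorem exists_isLeast_of_isClosed_of_infClosed {K : Type*} [TopologicalSpace K]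
    [CompactSpace K] [T2Space K] [SemilatticeInf K]
    (hmeet : Continuous fun x : K × K => x.1 ⊓ x.2) {V : Set K} (hV : IsClosed V)
    (hne : V.Nonempty) (hinf : InfClosed V) : ∃ p, IsLeast V p := by
  have : Nonempty V := hne.to_subtype
  have hcl (a : V) : IsClosed (V ∩ Set.Iic (a : K)) :=
    hV.inter (isClosed_Iic_of_continuous_inf hmeet _)
  obtain ⟨p, hp⟩ := IsCompact.nonempty_iInter_of_directed_nonempty_isCompact_isClosed
    (fun a : V => V ∩ Set.Iic (a : K))
    (fun a b => ⟨⟨a ⊓ b, hinf a.2 b.2⟩,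
      Set.inter_subset_inter_right _ (Set.Iic_subset_Iic.2 inf_le_left),
      Set.inter_subset_inter_right _ (Set.Iic_subset_Iic.2 inf_le_right)⟩)
    (fun a => ⟨a, a.2, le_rfl⟩) (fun a => (hcl a).isCompact) hcl
  rw [Set.mem_iInter] at hp
  exact ⟨p, (hp (Classical.arbitrary V)).1, fun a ha => (hp ⟨a, ha⟩).2⟩

/-- Every clopen neighbourhood of a point of a compact semilattice contains a clopen
subsemilattice containing that point, namely its class in the syntactic congruence. -/
theorem exists_isClopen_infClosed_subset {K : Type*} [TopologicalSpace K] [CompactSpace K]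
    [SemilatticeInf K] (hmeet : Continuous fun x : K × K => x.1 ⊓ x.2) {C : Set K}
    (hC : IsClopen C) {x : K} (hx : x ∈ C) :
    ∃ V ⊆ C, IsClopen V ∧ InfClosed V ∧ x ∈ V := by
  let R : Set (K × K) := {q | q.1 ⊓ q.2 ∈ C ↔ x ⊓ q.2 ∈ C}
  have hR : IsClopen R := by
    have h₁ : IsClopen {q : K × K | q.1 ⊓ q.2 ∈ C} := hC.preimage hmeet
    have h₂ : IsClopen {q : K × K | x ⊓ q.2 ∈ C} :=
      hC.preimage (hmeet.comp (continuous_const.prodMk continuous_snd))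
    have h : R = ({q : K × K | q.1 ⊓ q.2 ∈ C} ∩ {q : K × K | x ⊓ q.2 ∈ C}) ∪
        ({q : K × K | q.1 ⊓ q.2 ∈ C}ᶜ ∩ {q : K × K | x ⊓ q.2 ∈ C}ᶜ) := by
      ext q
      simp only [R, Set.mem_ofPred_eq, Set.mem_union, Set.mem_inter_iff, Set.mem_compl_iff]
      tauto
    rw [h]
    exact (h₁.inter h₂).union (h₁.compl.inter h₂.compl)
  have hS : IsClopen {a : K | ∀ s, (a, s) ∈ R} := by
    constructor
    · rw [Set.ofPred_forall]
      exact isClosed_iInter fun s => hR.1.preimage (continuous_id.prodMk continuous_const)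
    · have h : {a : K | ∀ s, (a, s) ∈ R} = (Prod.fst '' Rᶜ)ᶜ := by
        ext a
        simp
      rw [h]
      exact (isClosedMap_fst_of_compactSpace _ hR.compl.1).isOpen_compl
  refine ⟨C ∩ {a | ∀ s, (a, s) ∈ R}, Set.inter_subset_left, hC.inter hS, ?_,
    hx, fun s => Iff.rfl⟩
  rintro a ⟨-, ha⟩ b ⟨-, hb⟩
  have ha' (s : K) : a ⊓ s ∈ C ↔ x ⊓ s ∈ C := ha s
  have hb' (s : K) : b ⊓ s ∈ C ↔ x ⊓ s ∈ C := hb s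
  refine ⟨?_, fun s => ?_⟩
  · rw [ha', inf_comm, hb', inf_idem]
    exact hx
  · change (a ⊓ b) ⊓ s ∈ C ↔ x ⊓ s ∈ C
    rw [inf_assoc, ha', inf_left_comm, hb', ← inf_assoc, inf_idem]

/-- In a profinite semilattice, clopen principal filters separate points. -/
theorem exists_isClopen_Ici_of_not_le {K : Type*} [TopologicalSpace K] [CompactSpace K]
    [T2Space K] [TotallyDisconnectedSpace K] [SemilatticeInf K]
    (hmeet : Continuous fun x : K × K => x.1 ⊓ x.2) {x y : K} (hxy : ¬x ≤ y) :
    ∃ p, IsClopen (Set.Ici p) ∧ p ≤ x ∧ ¬p ≤ y := by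
  obtain ⟨C, hC, hxC, hCy⟩ := compact_exists_isClopen_in_isOpen
    (isClosed_Iic_of_continuous_inf hmeet y).isOpen_compl (show x ∈ (Set.Iic y)ᶜ from hxy)
  obtain ⟨V, hVC, hV, hinf, hxV⟩ := exists_isClopen_infClosed_subset hmeet hC hxC
  obtain ⟨p, hpV, hp⟩ := exists_isLeast_of_isClosed_of_infClosed hmeet hV.1 ⟨x, hxV⟩ hinf
  refine ⟨p, ?_, hp hxV, hCy (hVC hpV)⟩
  have h : Set.Ici p = (fun z => z ⊓ p) ⁻¹' V := by
    ext z
    refine ⟨fun hz => ?_, fun hz => (hp hz).trans inf_le_left⟩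
    rwa [Set.mem_preimage, inf_eq_right.2 hz]
  rw [h]
  exact hV.preimage (hmeet.comp (continuous_id.prodMk continuous_const))


/-- A compact topology equals every coarser Hausdorff topology. -/
theorem eq_of_le_of_compactSpace_of_t2Space {X : Type*} {t g : TopologicalSpace X}
    (ht : @CompactSpace X t) (hg : @T2Space X g) (hle : t ≤ g) : t = g := by
  refine le_antisymm hle fun U hU => ?_
  have hclosed : @IsClosedMap X X t g id :=
    @Continuous.isClosedMap X X t g ht hg id (continuous_id_iff_le.2 hle)
  have h := hclosed Uᶜ (@IsOpen.isClosed_compl X t U hU)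
  rw [Set.image_id] at h
  exact (@isClosed_compl_iff X g U).1 h

/-- In a compact Hausdorff totally disconnected topological meet-semilattice with
least element `0` and jointly continuous meet, the topology coincides with the
topology generated by all clopen principal filters `[p,→)` (for `p` a compact
element) together with their complements. -/
theorem stmt2 {K : Type*} [t : TopologicalSpace K] [CompactSpace K] [T2Space K]
    [TotallyDisconnectedSpace K] [SemilatticeInf K] [OrderBot K]
    (hmeet : Continuous fun x : K × K => x.1 ⊓ x.2) :
    t = TopologicalSpace.generateFrom
      {S : Set K | ∃ p : K, CompactElem p ∧ IsClopen (Set.Ici p) ∧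
        (S = Set.Ici p ∨ S = (Set.Ici p)ᶜ)} := by
  refine eq_of_le_of_compactSpace_of_t2Space inferInstance ?_ ?_
  · refine @T2Space.mk K (_) fun x y hxy => ?_
    by_cases h : x ≤ y
    · obtain ⟨p, hp, hpy, hpx⟩ := exists_isClopen_Ici_of_not_le hmeet
        fun h' : y ≤ x => hxy (le_antisymm h h')
      have hc := compactElem_of_isOpen_Ici hmeet hp.2
      exact ⟨_, _, .basic _ ⟨p, hc, hp, .inr rfl⟩, .basic _ ⟨p, hc, hp, .inl rfl⟩,
        hpx, hpy, disjoint_compl_left⟩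
    · obtain ⟨p, hp, hpx, hpy⟩ := exists_isClopen_Ici_of_not_le hmeet h
      have hc := compactElem_of_isOpen_Ici hmeet hp.2
      exact ⟨_, _, .basic _ ⟨p, hc, hp, .inl rfl⟩, .basic _ ⟨p, hc, hp, .inr rfl⟩,
        hpx, hpy, disjoint_compl_right⟩
  · refine le_generateFrom ?_
    rintro S ⟨p, -, hp, rfl | rfl⟩
    exacts [hp.2, hp.compl.2]
end

section
/- Let K be a compact Hausdorff topological distributive lattice whose operations ⊓ and ⊔ are jointly continuous, and let A and B be disjoint nonempty closed convex subsets of K. Then there exists a gate (a₁, b₁) between A and B: elements a₁ ∈ A and b₁ ∈ B such that a₁ ∈ [x, b₁] for every x ∈ A, b₁ ∈ [a₁, y] for every y ∈ B, A ∩ [a₁, b₁] = {a₁}, and B ∩ [a₁, b₁] = {b₁}. -/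
/-- A *filter* in a lattice: for all `a, b ∈ F`, every `x` with `a ⊓ b ≤ x` belongs to `F`. -/
def IsLatFilter {K : Type*} [Lattice K] (F : Set K) : Prop :=
  ∀ a ∈ F, ∀ b ∈ F, ∀ x : K, a ⊓ b ≤ x → x ∈ F

/-- An *ideal* in a lattice: for all `a, b ∈ I`, every `x` with `x ≤ a ⊔ b` belongs to `I`. -/
def IsLatIdeal {K : Type*} [Lattice K] (I : Set K) : Prop :=
  ∀ a ∈ I, ∀ b ∈ I, ∀ x : K, x ≤ a ⊔ b → x ∈ I

/-- A subset is *convex* if it is the intersection of an ideal and a filter. -/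
def IsLatConvex {K : Type*} [Lattice K] (G : Set K) : Prop :=
  ∃ I F : Set K, IsLatIdeal I ∧ IsLatFilter F ∧ G = I ∩ F

/-- The interval `[a,b] = {x : a ⊓ b ≤ x ≤ a ⊔ b}` in a lattice. -/
def LatInterval {K : Type*} [Lattice K] (a b : K) : Set K :=
  Set.Icc (a ⊓ b) (a ⊔ b)

/-- A nonempty compact inf-closed subset of a semilattice with closed lower rays has a least
element. -/
theorem IsCompact.exists_isLeast_of_infClosed {K : Type*} [TopologicalSpace K] [SemilatticeInf K]
    [ClosedIicTopology K] {s : Set K} (hs : IsCompact s) (hscl : IsClosed s) (hne : s.Nonempty)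
    (hinf : InfClosed s) : ∃ p, IsLeast s p := by
  have : Nonempty s := hne.to_subtype
  obtain ⟨p, hp⟩ := IsCompact.nonempty_iInter_of_directed_nonempty_isCompact_isClosed
    (fun a : s => s ∩ Set.Iic (a : K))
    (fun a b => ⟨⟨a ⊓ b, hinf a.2 b.2⟩,
      fun _ hx => ⟨hx.1, hx.2.trans inf_le_left⟩, fun _ hx => ⟨hx.1, hx.2.trans inf_le_right⟩⟩)
    (fun a => ⟨a, a.2, le_rfl⟩)
    (fun a => hs.inter_right isClosed_Iic)
    (fun a => hscl.inter isClosed_Iic)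
  rw [Set.mem_iInter] at hp
  exact ⟨p, (hp ⟨_, hne.some_mem⟩).1, fun a ha => (hp ⟨a, ha⟩).2⟩

theorem IsLatConvex.infClosed {K : Type*} [Lattice K] {G : Set K} (hG : IsLatConvex G) :
    InfClosed G := by
  obtain ⟨I, F, hI, hF, rfl⟩ := hG
  exact fun a ha b hb =>
    ⟨hI a ha.1 b hb.1 _ (inf_le_left.trans le_sup_left), hF a ha.2 b hb.2 _ le_rfl⟩

theorem IsLatConvex.supClosed {K : Type*} [Lattice K] {G : Set K} (hG : IsLatConvex G) :
    SupClosed G := by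
  obtain ⟨I, F, hI, hF, rfl⟩ := hG
  exact fun a ha b hb =>
    ⟨hI a ha.1 b hb.1 _ le_rfl, hF a ha.2 b hb.2 _ (inf_le_left.trans le_sup_left)⟩

theorem IsLatConvex.ordConnected {K : Type*} [Lattice K] {G : Set K} (hG : IsLatConvex G) :
    G.OrdConnected := by
  obtain ⟨I, F, hI, hF, rfl⟩ := hG
  exact ⟨fun a ha b hb x hx =>
    ⟨hI b hb.1 b hb.1 x (hx.2.trans le_sup_left), hF a ha.2 a ha.2 x (inf_le_left.trans hx.1)⟩⟩

/-- In a compact Hausdorff topological lattice, nonempty closed convex sets are intervals. -/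
theorem IsLatConvex.exists_eq_Icc {K : Type*} [TopologicalSpace K] [CompactSpace K] [T2Space K]
    [Lattice K] (hmeet : Continuous fun x : K × K => x.1 ⊓ x.2) {G : Set K}
    (hG : IsLatConvex G) (hcl : IsClosed G) (hne : G.Nonempty) :
    ∃ p q, p ≤ q ∧ G = Set.Icc p q := by
  have : ContinuousInf K := ⟨hmeet⟩
  have : OrderClosedTopology K := ⟨by
    simp only [← inf_eq_left]
    exact isClosed_eq hmeet continuous_fst⟩
  obtain ⟨p, hpG, hp⟩ := hcl.isCompact.exists_isLeast_of_infClosed hcl hne hG.infClosed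
  obtain ⟨q, hqG, hq⟩ : ∃ q, IsGreatest G q :=
    IsCompact.exists_isLeast_of_infClosed (K := Kᵒᵈ) hcl.isCompact hcl hne hG.supClosed
  exact ⟨p, q, hp hqG, Set.Subset.antisymm (fun x hx => ⟨hp hx, hq hx⟩)
    (hG.ordConnected.out hpG hqG)⟩

theorem mem_LatInterval_of_projection {K : Type*} [DistribLattice K] {p q b x : K}
    (hx : x ∈ Set.Icc p q) : p ⊔ b ⊓ q ∈ LatInterval x b :=
  ⟨le_sup_of_le_right (le_inf inf_le_right (inf_le_left.trans hx.2)),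
    sup_le_sup hx.1 inf_le_left⟩

theorem LatInterval_comm {K : Type*} [Lattice K] (a b : K) :
    LatInterval a b = LatInterval b a := by
  rw [LatInterval, LatInterval, inf_comm, sup_comm]

theorem eq_of_mem_LatInterval {K : Type*} [DistribLattice K] {a b x : K}
    (ha : a ∈ LatInterval x b) (hx : x ∈ LatInterval a b) : x = a :=
  eq_of_inf_eq_sup_eq (a := b)
    (le_antisymm (le_inf ha.1 inf_le_right) (le_inf hx.1 inf_le_right))
    (le_antisymm (sup_le hx.2 le_sup_right) (sup_le ha.2 le_sup_right))

theorem inter_LatInterval_eq_singleton {K : Type*} [DistribLattice K] {A : Set K} {a b : K}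
    (haA : a ∈ A) (h : ∀ x ∈ A, a ∈ LatInterval x b) : A ∩ LatInterval a b = {a} :=
  Set.Subset.antisymm (fun x hx => eq_of_mem_LatInterval (h x hx.1) hx.2)
    (Set.singleton_subset_iff.2 ⟨haA, inf_le_left, le_sup_left⟩)

/-- Projecting `r ⊔ p ⊓ s` onto `[p, q]` gives the same point as projecting `r`. -/
theorem sup_sup_inf_inf_eq {K : Type*} [DistribLattice K] (p q r s : K) :
    p ⊔ (r ⊔ p ⊓ s) ⊓ q = p ⊔ r ⊓ q := by
  rw [inf_sup_right, sup_comm (r ⊓ q), ← sup_assoc,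
    sup_eq_left.2 (inf_le_left.trans inf_le_left : p ⊓ s ⊓ q ≤ p)]

/-- In a compact Hausdorff topological distributive lattice with jointly continuous
operations, between any two disjoint nonempty closed convex sets `A`, `B` there
exists a gate `(a₁, b₁)`. -/
theorem stmt7 {K : Type*} [TopologicalSpace K] [CompactSpace K] [T2Space K]
    [Nonempty K] [DistribLattice K]
    (hmeet : Continuous fun x : K × K => x.1 ⊓ x.2)
    (hjoin : Continuous fun x : K × K => x.1 ⊔ x.2)
    (A B : Set K) (hA : IsClosed A) (hB : IsClosed B)
    (hAconv : IsLatConvex A) (hBconv : IsLatConvex B)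
    (hAne : A.Nonempty) (hBne : B.Nonempty) (hdisj : A ∩ B = ∅) :
    ∃ a₁ ∈ A, ∃ b₁ ∈ B,
      (∀ x ∈ A, a₁ ∈ LatInterval x b₁) ∧
      (∀ y ∈ B, b₁ ∈ LatInterval a₁ y) ∧
      A ∩ LatInterval a₁ b₁ = {a₁} ∧
      B ∩ LatInterval a₁ b₁ = {b₁} := by
  obtain ⟨p, q, hpq, rfl⟩ := hAconv.exists_eq_Icc hmeet hA hAne
  obtain ⟨r, s, hrs, rfl⟩ := hBconv.exists_eq_Icc hmeet hB hBne
  have ha : ∀ x ∈ Set.Icc p q, p ⊔ r ⊓ q ∈ LatInterval x (r ⊔ p ⊓ s) := fun x hx =>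
    sup_sup_inf_inf_eq p q r s ▸ mem_LatInterval_of_projection hx
  have hb : ∀ y ∈ Set.Icc r s, r ⊔ p ⊓ s ∈ LatInterval y (p ⊔ r ⊓ q) := fun y hy =>
    sup_sup_inf_inf_eq r s p q ▸ mem_LatInterval_of_projection hy
  have haA : p ⊔ r ⊓ q ∈ Set.Icc p q := ⟨le_sup_left, sup_le hpq inf_le_right⟩
  have hbB : r ⊔ p ⊓ s ∈ Set.Icc r s := ⟨le_sup_left, sup_le hrs inf_le_right⟩
  refine ⟨_, haA, _, hbB, ha, fun y hy => ?_, inter_LatInterval_eq_singleton haA ha, ?_⟩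
  · rw [LatInterval_comm]
    exact hb y hy
  · rw [LatInterval_comm]
    exact inter_LatInterval_eq_singleton hbB hb
end
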